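/- Let d ≥ 1 and let E₁₁, E₁₂, E₂₁, E₂₂ be real d×d matrices such that E₁₂ and E₂₂ are invertible and the block matrix E = [[E₁₁,E₁₂],[E₂₁,E₂₂]] is invertible. Then for all Schwartz functions f, g, φ, ψ on ℝᵈ, Moyal's identity holds: ∫_{ℝ^{2d}} W_E(f,g)(z) · conj(W_E(φ,ψ)(z)) dz = ( ∫_{ℝᵈ} f(t) conj(φ(t)) dt ) · conj( ∫_{ℝᵈ} g(t) conj(ψ(t)) dt ). -/

import Mathlib

open MeasureTheory Matrix

/-- The totally Wigner-decomposable metaplectic Wigner distribution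
`W_E(f,g)(x,ξ) = |det E|^{1/2} ∫ f(E₁₁x + E₁₂t) conj(g(E₂₁x + E₂₂t)) e^{-2πi ξ·t} dt`. -/
noncomputable def WE {d : ℕ} (E11 E12 E21 E22 : Matrix (Fin d) (Fin d) ℝ)
    (f g : (Fin d → ℝ) → ℂ) (x ξ : Fin d → ℝ) : ℂ :=
  ((Real.sqrt |(Matrix.fromBlocks E11 E12 E21 E22).det| : ℝ) : ℂ) *
    ∫ t : Fin d → ℝ,
      f (E11 *ᵥ x + E12 *ᵥ t) * (starRingEnd ℂ) (g (E21 *ᵥ x + E22 *ᵥ t)) *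
        Complex.exp (-2 * Real.pi * Complex.I * ((ξ ⬝ᵥ t : ℝ) : ℂ))

open scoped FourierTransform ComplexConjugate

/-- The Fourier transform on `ℝᵈ`, in the normalization of `WE`. -/
noncomputable def fourierPi {d : ℕ} (h : (Fin d → ℝ) → ℂ) (ξ : Fin d → ℝ) : ℂ :=
  ∫ t : Fin d → ℝ, h t * Complex.exp (-2 * Real.pi * Complex.I * ((ξ ⬝ᵥ t : ℝ) : ℂ))

/-- A Schwartz function on `ℝᵈ`, transported to Euclidean space. -/
noncomputable def schwartzToEuclidean {d : ℕ} (h : SchwartzMap (Fin d → ℝ) ℂ) :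
    SchwartzMap (EuclideanSpace ℝ (Fin d)) ℂ :=
  SchwartzMap.compCLMOfContinuousLinearEquiv ℝ (EuclideanSpace.equiv (Fin d) ℝ) h

theorem schwartzToEuclidean_toLp {d : ℕ} (h : SchwartzMap (Fin d → ℝ) ℂ) (t : Fin d → ℝ) :
    schwartzToEuclidean h (WithLp.toLp 2 t) = h t := rfl

theorem integral_comp_toLp {d : ℕ} (F : EuclideanSpace ℝ (Fin d) → ℂ) :
    ∫ t : Fin d → ℝ, F (WithLp.toLp 2 t) = ∫ y, F y :=
  (PiLp.volume_preserving_toLp (Fin d)).integral_comp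
    (MeasurableEquiv.toLp 2 (Fin d → ℝ)).measurableEmbedding F

theorem fourierPi_eq {d : ℕ} (h : SchwartzMap (Fin d → ℝ) ℂ) (ξ : Fin d → ℝ) :
    fourierPi h ξ = 𝓕 (schwartzToEuclidean h) (WithLp.toLp 2 ξ) := by
  rw [SchwartzMap.fourier_coe, Real.fourier_eq', ← integral_comp_toLp, fourierPi]
  refine integral_congr_ae (.of_forall fun t ↦ ?_)
  simp only [schwartzToEuclidean_toLp, smul_eq_mul, EuclideanSpace.inner_toLp_toLp, star_trivial]
  rw [mul_comm]
  congr 2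
  push_cast
  ring

theorem integral_fourierPi_mul_conj {d : ℕ} (h k : SchwartzMap (Fin d → ℝ) ℂ) :
    ∫ ξ, fourierPi h ξ * conj (fourierPi k ξ) = ∫ t, h t * conj (k t) := by
  simp_rw [fourierPi_eq]
  rw [integral_comp_toLp fun y ↦ 𝓕 (schwartzToEuclidean h) y * conj (𝓕 (schwartzToEuclidean k) y)]
  have := SchwartzMap.integral_inner_fourier_fourier (schwartzToEuclidean k) (schwartzToEuclidean h)
  simp only [RCLike.inner_apply] at this
  rw [this, ← integral_comp_toLp]
  simp_rw [schwartzToEuclidean_toLp]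

theorem memLp_two_fourierPi {d : ℕ} (h : SchwartzMap (Fin d → ℝ) ℂ) :
    MemLp (fourierPi h) 2 := by
  have := ((𝓕 (schwartzToEuclidean h)).memLp 2).comp_measurePreserving
    (PiLp.volume_preserving_toLp (Fin d))
  exact this.ae_eq (.of_forall fun ξ ↦ (fourierPi_eq h ξ).symm)

theorem integral_norm_sq_fourierPi {d : ℕ} (h : SchwartzMap (Fin d → ℝ) ℂ) :
    ∫ ξ, ‖fourierPi h ξ‖ ^ 2 = ∫ t, ‖h t‖ ^ 2 := by
  have := integral_fourierPi_mul_conj h h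
  simp_rw [Complex.mul_conj'] at this
  exact_mod_cast this

theorem MeasureTheory.MemLp.integrable_mul_conj {α : Type*} [MeasurableSpace α] {μ : Measure α}
    {F G : α → ℂ} (hF : MemLp F 2 μ) (hG : MemLp G 2 μ) :
    Integrable (fun z ↦ F z * conj (G z)) μ :=
  hF.integrable_mul hG.star

section PartialFourier

variable {d : ℕ} {X : Type*} [TopologicalSpace X] [MeasurableSpace X] [OpensMeasurableSpace X]
  {μ : Measure X}

theorem memLp_two_fourierPi_slice {H : X → (Fin d → ℝ) → ℂ}
    (hH : Continuous fun z : X × (Fin d → ℝ) ↦ H z.1 z.2)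
    (hS : ∀ x, ∃ h : SchwartzMap (Fin d → ℝ) ℂ, H x = h)
    (hL : MemLp (fun z : X × (Fin d → ℝ) ↦ H z.1 z.2) 2 (μ.prod volume)) :
    MemLp (fun z : X × (Fin d → ℝ) ↦ fourierPi (H z.1) z.2) 2 (μ.prod volume) := by
  have hm : StronglyMeasurable fun z : X × (Fin d → ℝ) ↦ fourierPi (H z.1) z.2 := by
    unfold fourierPi
    refine StronglyMeasurable.integral_prod_right (f := fun (z : X × (Fin d → ℝ)) t ↦ H z.1 t *
      Complex.exp (-2 * Real.pi * Complex.I * ((z.2 ⬝ᵥ t : ℝ) : ℂ))) ?_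
    refine Continuous.stronglyMeasurable ?_
    have h1 : Continuous fun p : (X × (Fin d → ℝ)) × (Fin d → ℝ) ↦ H p.1.1 p.2 :=
      hH.comp (by fun_prop : Continuous fun p : (X × (Fin d → ℝ)) × (Fin d → ℝ) ↦ (p.1.1, p.2))
    have h2 : Continuous fun p : (X × (Fin d → ℝ)) × (Fin d → ℝ) ↦ p.1.2 ⬝ᵥ p.2 :=
      Continuous.dotProduct (by fun_prop) (by fun_prop)
    simp only [Function.uncurry_def]
    fun_prop
  rw [memLp_two_iff_integrable_sq_norm hm.aestronglyMeasurable,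
    integrable_prod_iff (by simpa only [Pi.pow_def] using (hm.norm.pow 2).aestronglyMeasurable)]
  rw [memLp_two_iff_integrable_sq_norm hL.1] at hL
  refine ⟨.of_forall fun x ↦ ?_, hL.integral_prod_left.congr (.of_forall fun x ↦ ?_)⟩
  · obtain ⟨h, hh⟩ := hS x
    have := memLp_two_fourierPi h
    simpa only [hh] using (memLp_two_iff_integrable_sq_norm this.1).1 this
  · obtain ⟨h, hh⟩ := hS x
    simp only [hh, norm_pow, norm_norm]
    exact (integral_norm_sq_fourierPi h).symm

theorem integral_fourierPi_slice_mul_conj [SFinite μ] {H K : X → (Fin d → ℝ) → ℂ}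
    (hH : Continuous fun z : X × (Fin d → ℝ) ↦ H z.1 z.2)
    (hHS : ∀ x, ∃ h : SchwartzMap (Fin d → ℝ) ℂ, H x = h)
    (hHL : MemLp (fun z : X × (Fin d → ℝ) ↦ H z.1 z.2) 2 (μ.prod volume))
    (hK : Continuous fun z : X × (Fin d → ℝ) ↦ K z.1 z.2)
    (hKS : ∀ x, ∃ h : SchwartzMap (Fin d → ℝ) ℂ, K x = h)
    (hKL : MemLp (fun z : X × (Fin d → ℝ) ↦ K z.1 z.2) 2 (μ.prod volume)) :
    ∫ z : X × (Fin d → ℝ), fourierPi (H z.1) z.2 * conj (fourierPi (K z.1) z.2) ∂(μ.prod volume) =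
      ∫ z : X × (Fin d → ℝ), H z.1 z.2 * conj (K z.1 z.2) ∂(μ.prod volume) := by
  rw [integral_prod _ ((memLp_two_fourierPi_slice hH hHS hHL).integrable_mul_conj
    (memLp_two_fourierPi_slice hK hKS hKL)), integral_prod _ (hHL.integrable_mul_conj hKL)]
  refine integral_congr_ae (.of_forall fun x ↦ ?_)
  obtain ⟨h, hh⟩ := hHS x
  obtain ⟨k, hk⟩ := hKS x
  simpa only [hh, hk] using integral_fourierPi_mul_conj h k

end PartialFourier

section BlockMap

variable {d : ℕ}

/-- The linear map on `ℝᵈ × ℝᵈ` given by a block matrix. -/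
noncomputable def blockLin (A B C D : Matrix (Fin d) (Fin d) ℝ) :
    ((Fin d → ℝ) × (Fin d → ℝ)) →ₗ[ℝ] ((Fin d → ℝ) × (Fin d → ℝ)) :=
  let e := LinearEquiv.sumArrowLequivProdArrow (Fin d) (Fin d) ℝ ℝ
  e.toLinearMap ∘ₗ Matrix.toLin' (Matrix.fromBlocks A B C D) ∘ₗ e.symm.toLinearMap

theorem blockLin_apply (A B C D : Matrix (Fin d) (Fin d) ℝ) (z : (Fin d → ℝ) × (Fin d → ℝ)) :
    blockLin A B C D z = (A *ᵥ z.1 + B *ᵥ z.2, C *ᵥ z.1 + D *ᵥ z.2) := by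
  have h1 : (LinearEquiv.sumArrowLequivProdArrow (Fin d) (Fin d) ℝ ℝ).symm z ∘ Sum.inl = z.1 := rfl
  have h2 : (LinearEquiv.sumArrowLequivProdArrow (Fin d) (Fin d) ℝ ℝ).symm z ∘ Sum.inr = z.2 := rfl
  simp only [blockLin, LinearMap.comp_apply, LinearEquiv.coe_coe, Matrix.toLin'_apply,
    Matrix.fromBlocks_mulVec, h1, h2]
  rfl

theorem det_blockLin (A B C D : Matrix (Fin d) (Fin d) ℝ) :
    LinearMap.det (blockLin A B C D) = (Matrix.fromBlocks A B C D).det := by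
  rw [blockLin, LinearMap.det_conj, LinearMap.det_toLin']

theorem map_blockLin {A B C D : Matrix (Fin d) (Fin d) ℝ}
    (hE : (Matrix.fromBlocks A B C D).det ≠ 0) :
    Measure.map (blockLin A B C D) volume =
      ENNReal.ofReal |(Matrix.fromBlocks A B C D).det⁻¹| • volume := by
  rw [← det_blockLin] at hE ⊢
  have : (volume : Measure ((Fin d → ℝ) × (Fin d → ℝ))).IsAddHaarMeasure :=
    Measure.prod.instIsAddHaarMeasure _ _
  exact Measure.map_linearMap_addHaar_eq_smul_addHaar _ hE

theorem integrable_comp_blockLin {A B C D : Matrix (Fin d) (Fin d) ℝ}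
    (hE : (Matrix.fromBlocks A B C D).det ≠ 0) {F : (Fin d → ℝ) × (Fin d → ℝ) → ℝ}
    (hF : Integrable F) : Integrable (fun z ↦ F (blockLin A B C D z)) := by
  refine Integrable.comp_measurable (g := F) ?_
    (LinearMap.continuous_of_finiteDimensional (blockLin A B C D)).measurable
  rw [map_blockLin hE]
  exact hF.smul_measure ENNReal.ofReal_ne_top

theorem integral_comp_blockLin {A B C D : Matrix (Fin d) (Fin d) ℝ}
    (hE : (Matrix.fromBlocks A B C D).det ≠ 0) {F : (Fin d → ℝ) × (Fin d → ℝ) → ℂ}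
    (hF : AEStronglyMeasurable F) :
    ((|(Matrix.fromBlocks A B C D).det| : ℝ) : ℂ) * ∫ z, F (blockLin A B C D z) = ∫ z, F z := by
  rw [← integral_map (f := F)
    (LinearMap.continuous_of_finiteDimensional (blockLin A B C D)).aemeasurable, map_blockLin hE,
    integral_smul_measure, ENNReal.toReal_ofReal (abs_nonneg _), Complex.real_smul, ← mul_assoc,
    ← Complex.ofReal_mul, ← abs_mul, mul_inv_cancel₀ hE]
  · simp
  · rw [map_blockLin hE]
    exact hF.smul_measure _

end BlockMap

section Slices

variable {d : ℕ}

theorem exists_schwartzMap_comp_affine {A : Matrix (Fin d) (Fin d) ℝ} (hA : IsUnit A)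
    (f : SchwartzMap (Fin d → ℝ) ℂ) (a : Fin d → ℝ) :
    ∃ h : SchwartzMap (Fin d → ℝ) ℂ, ∀ t, h t = f (a + A *ᵥ t) := by
  have hdet : IsUnit A.det := (Matrix.isUnit_iff_isUnit_det A).1 hA
  let e : (Fin d → ℝ) ≃L[ℝ] (Fin d → ℝ) :=
    (Matrix.toLinearEquiv' A (A.invertibleOfIsUnitDet hdet)).toContinuousLinearEquiv
  refine ⟨SchwartzMap.compCLMOfContinuousLinearEquiv ℝ e (f.compSubConstCLM ℝ (-a)), fun t ↦ ?_⟩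
  have : e t = A *ᵥ t := rfl
  simp [this, add_comm]

theorem exists_schwartzMap_slice {A B : Matrix (Fin d) (Fin d) ℝ} (hA : IsUnit A) (hB : IsUnit B)
    (f g : SchwartzMap (Fin d → ℝ) ℂ) (a b : Fin d → ℝ) :
    ∃ h : SchwartzMap (Fin d → ℝ) ℂ,
      (fun t ↦ f (a + A *ᵥ t) * conj (g (b + B *ᵥ t))) = h := by
  obtain ⟨f', hf⟩ := exists_schwartzMap_comp_affine hA f a
  obtain ⟨g', hg⟩ := exists_schwartzMap_comp_affine hB g b
  refine ⟨SchwartzMap.pairing (ContinuousLinearMap.mul ℝ ℂ) f'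
    (g'.postcompCLM (𝕜 := ℝ) (Complex.conjCLE : ℂ →L[ℝ] ℂ)), funext fun t ↦ ?_⟩
  simp [hf, hg]

theorem continuous_slice (E11 E12 E21 E22 : Matrix (Fin d) (Fin d) ℝ)
    (f g : SchwartzMap (Fin d → ℝ) ℂ) :
    Continuous fun z : (Fin d → ℝ) × (Fin d → ℝ) ↦
      f (E11 *ᵥ z.1 + E12 *ᵥ z.2) * conj (g (E21 *ᵥ z.1 + E22 *ᵥ z.2)) := by
  have h (M N : Matrix (Fin d) (Fin d) ℝ) :
      Continuous fun z : (Fin d → ℝ) × (Fin d → ℝ) ↦ M *ᵥ z.1 + N *ᵥ z.2 :=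
    (continuous_const.matrix_mulVec continuous_fst).add
      (continuous_const.matrix_mulVec continuous_snd)
  exact (f.continuous.comp (h _ _)).mul (Complex.continuous_conj.comp (g.continuous.comp (h _ _)))

theorem memLp_two_slice {E11 E12 E21 E22 : Matrix (Fin d) (Fin d) ℝ}
    (hE : (Matrix.fromBlocks E11 E12 E21 E22).det ≠ 0) (f g : SchwartzMap (Fin d → ℝ) ℂ) :
    MemLp (fun z : (Fin d → ℝ) × (Fin d → ℝ) ↦
      f (E11 *ᵥ z.1 + E12 *ᵥ z.2) * conj (g (E21 *ᵥ z.1 + E22 *ᵥ z.2))) 2 := by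
  rw [memLp_two_iff_integrable_sq_norm (continuous_slice E11 E12 E21 E22 f g).aestronglyMeasurable]
  have hsq (u : SchwartzMap (Fin d → ℝ) ℂ) : Integrable fun t ↦ ‖u t‖ ^ 2 :=
    (memLp_two_iff_integrable_sq_norm (u.memLp 2).1).1 (u.memLp 2)
  have := integrable_comp_blockLin hE ((hsq f).mul_prod (hsq g))
  simpa only [blockLin_apply, norm_mul, mul_pow, RCLike.norm_conj] using this

end Slices

theorem WE_eq_fourierPi {d : ℕ} (E11 E12 E21 E22 : Matrix (Fin d) (Fin d) ℝ)
    (f g : (Fin d → ℝ) → ℂ) (x ξ : Fin d → ℝ) :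
    WE E11 E12 E21 E22 f g x ξ =
      ((Real.sqrt |(Matrix.fromBlocks E11 E12 E21 E22).det| : ℝ) : ℂ) *
        fourierPi (fun t ↦ f (E11 *ᵥ x + E12 *ᵥ t) * conj (g (E21 *ᵥ x + E22 *ᵥ t))) ξ := rfl

theorem WE_Moyal {d : ℕ} (hd : 1 ≤ d)
    (E11 E12 E21 E22 : Matrix (Fin d) (Fin d) ℝ)
    (h12 : IsUnit E12) (h22 : IsUnit E22)
    (hE : IsUnit (Matrix.fromBlocks E11 E12 E21 E22))
    (f g φ ψ : SchwartzMap (Fin d → ℝ) ℂ) :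
    ∫ z : (Fin d → ℝ) × (Fin d → ℝ),
        WE E11 E12 E21 E22 f g z.1 z.2 *
          (starRingEnd ℂ) (WE E11 E12 E21 E22 φ ψ z.1 z.2) =
      (∫ t : Fin d → ℝ, f t * (starRingEnd ℂ) (φ t)) *
        (starRingEnd ℂ) (∫ t : Fin d → ℝ, g t * (starRingEnd ℂ) (ψ t)) := by
  have hdet : (Matrix.fromBlocks E11 E12 E21 E22).det ≠ 0 :=
    ((Matrix.isUnit_iff_isUnit_det _).1 hE).ne_zero
  have hsqrt (a b : ℂ) : ((Real.sqrt |(Matrix.fromBlocks E11 E12 E21 E22).det| : ℝ) : ℂ) * a *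
      conj (((Real.sqrt |(Matrix.fromBlocks E11 E12 E21 E22).det| : ℝ) : ℂ) * b) =
      ((|(Matrix.fromBlocks E11 E12 E21 E22).det| : ℝ) : ℂ) * (a * conj b) := by
    rw [map_mul, Complex.conj_ofReal, mul_mul_mul_comm, ← Complex.ofReal_mul,
      Real.mul_self_sqrt (abs_nonneg _)]
  let F : (Fin d → ℝ) × (Fin d → ℝ) → ℂ := fun w ↦
    (f w.1 * conj (φ w.1)) * conj (g w.2 * conj (ψ w.2))
  have hF : Continuous F := by
    have := Complex.continuous_conj
    have := f.continuous
    have := g.continuous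
    have := φ.continuous
    have := ψ.continuous
    fun_prop
  simp_rw [WE_eq_fourierPi, hsqrt]
  rw [integral_const_mul, Measure.volume_eq_prod, integral_fourierPi_slice_mul_conj
    (continuous_slice E11 E12 E21 E22 f g)
    (fun x ↦ exists_schwartzMap_slice h12 h22 f g _ _) (memLp_two_slice hdet f g)
    (continuous_slice E11 E12 E21 E22 φ ψ)
    (fun x ↦ exists_schwartzMap_slice h12 h22 φ ψ _ _) (memLp_two_slice hdet φ ψ),
    ← integral_conj, ← integral_prod_mul, ← Measure.volume_eq_prod]
  refine Eq.trans ?_ (integral_comp_blockLin hdet hF.aestronglyMeasurable)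
  congr 2 with z
  simp only [blockLin_apply, map_mul, Complex.conj_conj]
  ring
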